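/- Let p > 0 and b₀ be real numbers, let U : ℝ → ℝ be continuous with U(t) ≥ p²·e^{2t} for all t, and let u : ℝ → ℝ be twice continuously differentiable with u″(t) = U(t)·u(t) for all t and u(t)·u′(t) > 0 for all t ≥ b₀. Then for all b ≥ b₀ one has u(b)·u′(b) ≥ (1/2)·p²·u(b₀)²·(e^{2b} − e^{2b₀}). -/

import Mathlib

/-- Growth estimate: if `u″ = U·u` with `U(t) ≥ p² e^{2t}` and `u·u′ > 0` on
`[b₀, ∞)`, then `u(b)u′(b) ≥ (1/2) p² u(b₀)² (e^{2b} − e^{2b₀})` for `b ≥ b₀`. -/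
theorem growth_estimate
    (p b₀ : ℝ) (hp : 0 < p) (U : ℝ → ℝ) (hU : Continuous U)
    (hUbd : ∀ t, p ^ 2 * Real.exp (2 * t) ≤ U t)
    (u : ℝ → ℝ) (hu : ContDiff ℝ 2 u)
    (heq : ∀ t, deriv (deriv u) t = U t * u t)
    (hpos : ∀ t ≥ b₀, 0 < u t * deriv u t) :
    ∀ b ≥ b₀, 1/2 * p ^ 2 * u b₀ ^ 2 * (Real.exp (2 * b) - Real.exp (2 * b₀))
      ≤ u b * deriv u b := by
  have hu1 : ∀ t, HasDerivAt u (deriv u t) t := fun t =>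
    (hu.differentiable (by norm_num) t).hasDerivAt
  have hu2 : ∀ t, HasDerivAt (deriv u) (U t * u t) t := fun t => by
    have hd : ContDiff ℝ 1 (deriv u) := (contDiff_succ_iff_deriv (n := 1)).mp hu |>.2.2
    simpa only [heq] using (hd.differentiable (by norm_num) t).hasDerivAt
  have hsq : MonotoneOn (fun t => u t ^ 2) (Set.Ici b₀) := by
    have hd : ∀ t, HasDerivAt (fun t => u t ^ 2) (2 * (u t * deriv u t)) t := fun t =>
      ((hu1 t).pow 2).congr_deriv (by push_cast; ring)
    refine monotoneOn_of_hasDerivWithinAt_nonneg (convex_Ici b₀)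
      (fun t _ => (hd t).continuousAt.continuousWithinAt)
      (fun t _ => (hd t).hasDerivWithinAt) fun t ht => ?_
    linarith [hpos t (interior_subset ht)]
  have hmono : MonotoneOn
      (fun t => u t * deriv u t - 1 / 2 * p ^ 2 * u b₀ ^ 2 * Real.exp (2 * t))
      (Set.Ici b₀) := by
    have hd : ∀ t, HasDerivAt
        (fun t => u t * deriv u t - 1 / 2 * p ^ 2 * u b₀ ^ 2 * Real.exp (2 * t))
        (deriv u t ^ 2 + U t * u t ^ 2 - p ^ 2 * Real.exp (2 * t) * u b₀ ^ 2) t := fun t =>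
      (((hu1 t).mul (hu2 t)).sub
        ((((hasDerivAt_id t).const_mul 2).exp).const_mul
          (1 / 2 * p ^ 2 * u b₀ ^ 2))).congr_deriv (by simp only [id]; ring)
    refine monotoneOn_of_hasDerivWithinAt_nonneg (convex_Ici b₀)
      (fun t _ => (hd t).continuousAt.continuousWithinAt)
      (fun t _ => (hd t).hasDerivWithinAt) fun t ht => ?_
    have ht' : t ∈ Set.Ici b₀ := interior_subset ht
    have hbound : p ^ 2 * Real.exp (2 * t) * u b₀ ^ 2 ≤ U t * u t ^ 2 :=
      mul_le_mul (hUbd t) (hsq Set.self_mem_Ici ht' ht') (sq_nonneg _)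
        (le_trans (by positivity) (hUbd t))
    linarith [sq_nonneg (deriv u t)]
  intro b hb
  have hle := hmono Set.self_mem_Ici hb hb
  have h₀ := hpos b₀ le_rfl
  simp only at hle
  linarith
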